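/- Let f ∈ ℤ[X] be monic of degree n, squarefree modulo a prime p, and suppose f mod p factors over 𝔽_p as a product of n − ℓ distinct monic linear factors and one monic irreducible factor of degree ℓ. Then the Galois group of the splitting field of f over ℚ, viewed as a permutation group on the roots of f, contains an ℓ-cycle. -/

import Mathlib

open Polynomial

attribute [local instance] Polynomial.Gal.splits_ℚ_ℂ

open NumberField

/-- Over a finite field with prime field `ZMod p`, the Frobenius acts transitively on the roots of
an irreducible polynomial over `ZMod p`. -/
lemma Irreducible.exists_pow_pow_eq_of_aeval_eq_zero {p : ℕ} [Fact p.Prime] {k : Type*} [Field k]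
    [Finite k] [Algebra (ZMod p) k] {q : (ZMod p)[X]} (hq : Irreducible q) {x y : k}
    (hx : aeval x q = 0) (hy : aeval y q = 0) : ∃ i : ℕ, x ^ p ^ i = y := by
  have hxy : minpoly (ZMod p) y = minpoly (ZMod p) x :=
    (minpoly.eq_of_irreducible hq hy).symm.trans (minpoly.eq_of_irreducible hq hx)
  obtain ⟨g, hg⟩ := (Normal.minpoly_eq_iff_mem_orbit k).mp hxy
  obtain ⟨i, rfl⟩ := (FiniteField.bijective_frobeniusAlgEquivOfAlgebraic_pow (ZMod p) k).2 g
  refine ⟨i, ?_⟩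
  simpa [AlgEquiv.smul_def, AlgEquiv.coe_pow,
    FiniteField.coe_frobeniusAlgEquivOfAlgebraic_iterate, ZMod.card] using hg

/-- A permutation which is intertwined with the Frobenius by an injection `r` into a finite field,
and whose points map to fixed points of the Frobenius or to roots of an irreducible polynomial `q`,
all of whose roots are attained, is a cycle of length the degree of `q`. -/
lemma Equiv.Perm.isCycle_and_card_support_of_frobenius {p : ℕ} [Fact p.Prime] {k : Type*} [Field k]
    [Finite k] [Algebra (ZMod p) k] {α : Type*} [Fintype α] [DecidableEq α] {π : Equiv.Perm α}
    {r : α → k} (hr : Function.Injective r) (hπ : ∀ a, r (π a) = r a ^ p)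
    {q : (ZMod p)[X]} (hq : Irreducible q) (hdeg : 2 ≤ q.natDegree)
    (hsplit : (q.map (algebraMap (ZMod p) k)).Splits)
    (hroots : ∀ a, r a ^ p = r a ∨ aeval (r a) q = 0)
    (hsurj : ∀ x, aeval x q = 0 → ∃ a, r a = x) :
    π.IsCycle ∧ π.support.card = q.natDegree := by
  classical
  have hcard : Fintype.card (q.rootSet k) = q.natDegree :=
    card_rootSet_eq_natDegree (PerfectField.separable_of_irreducible hq) hsplit
  have hnt : Nontrivial (q.rootSet k) := Fintype.one_lt_card_iff_nontrivial.mp (by omega)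
  have hmem (x : k) : x ∈ q.rootSet k ↔ aeval x q = 0 := by
    rw [mem_rootSet, and_iff_right hq.ne_zero]
  have hpow (a : α) (i : ℕ) : r ((π ^ i) a) = r a ^ p ^ i := by
    induction i with
    | zero => simp
    | succ i ih => rw [pow_succ', Equiv.Perm.mul_apply, hπ, ih, ← pow_mul, pow_succ]
  have hfix (x : k) (hx : x ^ p = x) (i : ℕ) : x ^ p ^ i = x := by
    induction i with
    | zero => simp
    | succ i ih => rw [pow_succ, pow_mul, ih, hx]
  have hsupp (a : α) : π a ≠ a ↔ aeval (r a) q = 0 := by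
    rw [← hr.ne_iff, hπ]
    refine ⟨(hroots a).resolve_left, fun ha hfixed ↦ ?_⟩
    obtain ⟨⟨y, hy⟩, hne⟩ := exists_ne (⟨r a, (hmem _).2 ha⟩ : q.rootSet k)
    obtain ⟨i, hi⟩ := hq.exists_pow_pow_eq_of_aeval_eq_zero ha ((hmem _).1 hy)
    exact hne (Subtype.ext (hi.symm.trans (hfix _ hfixed i)))
  refine ⟨?_, ?_⟩
  · obtain ⟨⟨x, hx⟩⟩ := hnt.to_nonempty
    obtain ⟨a, rfl⟩ := hsurj x ((hmem x).1 hx)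
    refine ⟨a, (hsupp a).2 ((hmem _).1 hx), fun b hb ↦ ?_⟩
    obtain ⟨i, hi⟩ := hq.exists_pow_pow_eq_of_aeval_eq_zero ((hmem _).1 hx) ((hsupp b).1 hb)
    exact ⟨i, hr (by rw [zpow_natCast, hpow, hi])⟩
  · rw [← hcard, ← Set.toFinset_card, ← Finset.card_image_of_injective _ hr]
    congr 1
    ext x
    simp only [Finset.mem_image, Equiv.Perm.mem_support, hsupp, Set.mem_toFinset, hmem]
    refine ⟨fun ⟨a, ha, hax⟩ ↦ hax ▸ ha, fun hx ↦ ?_⟩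
    obtain ⟨a, rfl⟩ := hsurj x hx
    exact ⟨a, hx, rfl⟩

/-- Frobenius elements exist at every prime `p` in a finite Galois extension of `ℚ`. -/
lemma exists_ringOfIntegers_frobenius (L : Type*) [Field L] [Algebra ℚ L] [FiniteDimensional ℚ L]
    [IsGalois ℚ L] (p : ℕ) [Fact p.Prime] :
    ∃ Q : Ideal (𝓞 L), Q.IsMaximal ∧ Finite (𝓞 L ⧸ Q) ∧ (p : 𝓞 L) ∈ Q ∧
      ∃ σ : Gal(L/ℚ), ∀ x y : 𝓞 L, (y : L) = σ x → y - x ^ p ∈ Q := by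
  have : CharZero L := algebraRat.charZero L
  obtain rfl : ‹Algebra ℚ L› = DivisionRing.toRatAlgebra := Subsingleton.elim _ _
  have : NumberField L := {}
  have hp : Prime (p : ℤ) := Nat.prime_iff_prime_int.mp Fact.out
  have : (Ideal.span {(p : ℤ)}).IsMaximal :=
    PrincipalIdealRing.isMaximal_of_irreducible hp.irreducible
  obtain ⟨Q, hQ, hQp⟩ := Ideal.exists_ideal_over_maximal_of_isIntegral (S := 𝓞 L)
    (Ideal.span {(p : ℤ)})
    ((RingHom.injective_iff_ker_eq_bot _).mp (algebraMap ℤ (𝓞 L)).injective_int ▸ bot_le)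
  have hpQ : (p : 𝓞 L) ∈ Q := by
    have : (p : ℤ) ∈ Ideal.comap (algebraMap ℤ (𝓞 L)) Q := hQp ▸ Ideal.mem_span_singleton_self _
    simpa using this
  have hfin : Finite (𝓞 L ⧸ Q) :=
    Ideal.finiteQuotientOfFreeOfNeBot Q (Q.bot_lt_of_maximal (RingOfIntegers.not_isField L)).ne'
  have hcard : Nat.card (ℤ ⧸ Q.under ℤ) = p := by
    rw [Ideal.under_def, hQp, Nat.card_congr (Int.quotientSpanNatEquivZMod p).toEquiv,
      Nat.card_zmod]
  obtain ⟨σ, hσ⟩ := IsArithFrobAt.exists_of_isInvariant ℤ Gal(L/ℚ) Q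
  refine ⟨Q, hQ, hfin, hpQ, σ, fun x y hxy ↦ ?_⟩
  obtain rfl : y = σ • x := RingOfIntegers.ext hxy
  simpa [hcard] using hσ x

/-- If a monic integral polynomial splits over `L`, then it splits over the integers of `L`. -/
lemma Polynomial.Monic.splits_map_ringOfIntegers {f : ℤ[X]} (hf : f.Monic) {L : Type*} [Field L]
    [CharZero L] (h : (f.map (algebraMap ℤ L)).Splits) : (f.map (algebraMap ℤ (𝓞 L))).Splits := by
  have hmap : (f.map (algebraMap ℤ (𝓞 L))).map (algebraMap (𝓞 L) L) = f.map (algebraMap ℤ L) := by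
    rw [map_map, ← IsScalarTower.algebraMap_eq]
  refine Splits.of_splits_map_of_injective RingOfIntegers.coe_injective (hmap ▸ h) fun a ha ↦ ?_
  rw [hmap, mem_roots', IsRoot.def, eval_map] at ha
  exact ⟨⟨a, f, hf, ha.2⟩, rfl⟩

/-- Dedekind's theorem on the splitting field `L` of `f`: if `f` is squarefree modulo `p`, with an
irreducible factor `q` of degree at least two and all other factors linear, then some element of
`Gal(L/ℚ)` permutes the roots of `f` as a cycle of length the degree of `q`. -/
lemma exists_gal_isCycle_of_factorization {f : ℤ[X]} (hmonic : f.Monic) {p : ℕ} [Fact p.Prime]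
    (hsqf : Squarefree (f.map (Int.castRingHom (ZMod p)))) {lin : Finset (ZMod p)}
    {q : (ZMod p)[X]} (hq : Irreducible q) (hdeg : 2 ≤ q.natDegree)
    (hfactor : f.map (Int.castRingHom (ZMod p)) = (∏ c ∈ lin, (X - C c)) * q)
    (L : Type*) [Field L] [Algebra ℚ L] [IsSplittingField ℚ L (f.map (Int.castRingHom ℚ))] :
    ∃ σ : Gal(L/ℚ), ∀ {α : Type} [Fintype α] [DecidableEq α]
      (e : α ≃ (f.map (Int.castRingHom ℚ)).rootSet L) (π : Equiv.Perm α),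
      (∀ a, (e (π a) : L) = σ (e a)) → π.IsCycle ∧ π.support.card = q.natDegree := by
  have hchar : CharZero L := algebraRat.charZero L
  have hfL : (f.map (Int.castRingHom ℚ)).map (algebraMap ℚ L) = f.map (algebraMap ℤ L) := by
    rw [map_map]
    exact congrArg f.map (RingHom.ext_int _ _)
  have hsplit : (f.map (algebraMap ℤ L)).Splits :=
    hfL ▸ IsSplittingField.splits L (f.map (Int.castRingHom ℚ))
  have : FiniteDimensional ℚ L := IsSplittingField.finiteDimensional L (f.map (Int.castRingHom ℚ))
  have : Normal ℚ L := .of_isSplittingField (f.map (Int.castRingHom ℚ))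
  have : IsGalois ℚ L := .mk
  obtain ⟨Q, hQ, _, hpQ, σ, hσ⟩ := exists_ringOfIntegers_frobenius L p
  let _ : Field (𝓞 L ⧸ Q) := Ideal.Quotient.field Q
  have : CharP (𝓞 L ⧸ Q) p := by
    refine (CharP.charP_iff_prime_eq_zero Fact.out).2 ?_
    rw [← map_natCast (Ideal.Quotient.mk Q)]
    exact Ideal.Quotient.eq_zero_iff_mem.2 hpQ
  let _ : Algebra (ZMod p) (𝓞 L ⧸ Q) := ZMod.algebra _ p
  have hsplitS := hmonic.splits_map_ringOfIntegers hsplit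
  set fS := f.map (algebraMap ℤ (𝓞 L)) with hfS
  have hred : fS.map (Ideal.Quotient.mk Q) =
      (f.map (Int.castRingHom (ZMod p))).map (algebraMap (ZMod p) (𝓞 L ⧸ Q)) := by
    rw [hfS, map_map, map_map]
    exact congrArg f.map (RingHom.ext_int _ _)
  have hfS0 : fS ≠ 0 := (hmonic.map _).ne_zero
  have hred0 : fS.map (Ideal.Quotient.mk Q) ≠ 0 := ((hmonic.map _).map _).ne_zero
  have hrootsmap := hsplitS.roots_map_of_ne_zero hred0
  have hnodup : (fS.roots.map (Ideal.Quotient.mk Q)).Nodup := by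
    rw [← hrootsmap, hred]
    exact nodup_roots (PerfectField.separable_iff_squarefree.2 hsqf).map
  have hmemL (x : L) : x ∈ (f.map (Int.castRingHom ℚ)).rootSet L ↔ aeval x f = 0 := by
    rw [mem_rootSet, and_iff_right (hmonic.map _).ne_zero, aeval_def, ← eval_map, hfL, eval_map,
      aeval_def]
  have hmemS (x : 𝓞 L) : x ∈ fS.roots ↔ aeval (x : L) f = 0 := by
    rw [mem_roots hfS0, IsRoot.def, eval_map, ← aeval_def, aeval_algebraMap_apply,
      RingOfIntegers.coe_eq_zero_iff]
  have hq_dvd : q ∣ f.map (Int.castRingHom (ZMod p)) := ⟨_, hfactor.trans (mul_comm _ _)⟩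
  refine ⟨σ, fun {α} _ _ e π hπ ↦ ?_⟩
  let s (a : α) : 𝓞 L := ⟨e a, f, hmonic, (hmemL _).1 (e a).2⟩
  have hs (a : α) : s a ∈ fS.roots := (hmemS _).2 ((hmemL _).1 (e a).2)
  have hs_inj : Function.Injective s := fun a b h ↦
    e.injective (Subtype.ext (congrArg (algebraMap _ L) h))
  have hs_surj (x) (hx : x ∈ fS.roots) : ∃ a, s a = x := by
    obtain ⟨a, ha⟩ := e.surjective ⟨x, (hmemL _).2 ((hmemS x).1 hx)⟩
    exact ⟨a, RingOfIntegers.ext (congrArg Subtype.val ha)⟩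
  have hroot (a : α) :
      aeval (Ideal.Quotient.mk Q (s a)) (f.map (Int.castRingHom (ZMod p))) = 0 := by
    have := Multiset.mem_map_of_mem (Ideal.Quotient.mk Q) (hs a)
    rw [← hrootsmap, hred, mem_roots', IsRoot.def, eval_map] at this
    exact this.2
  refine Equiv.Perm.isCycle_and_card_support_of_frobenius
    (r := fun a ↦ Ideal.Quotient.mk Q (s a)) (fun a b h ↦ hs_inj ?_) (fun a ↦ ?_) hq hdeg
    ?_ (fun a ↦ ?_) (fun x hx ↦ ?_)
  · exact Multiset.inj_on_of_nodup_map hnodup _ (hs a) _ (hs b) h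
  · rw [← map_pow, Ideal.Quotient.eq]
    exact hσ _ _ (hπ a)
  · exact (hred ▸ hsplitS.map _).of_dvd (hred ▸ hred0) (Polynomial.map_dvd _ hq_dvd)
  · have := hroot a
    rw [hfactor, map_mul, mul_eq_zero, map_prod, Finset.prod_eq_zero_iff] at this
    refine this.imp_left ?_
    rintro ⟨c, -, hc⟩
    rw [map_sub, aeval_X, aeval_C, sub_eq_zero] at hc
    rw [hc, ← map_pow, ZMod.pow_card]
  · have hx' : x ∈ fS.roots.map (Ideal.Quotient.mk Q) := by
      rw [← hrootsmap, mem_roots hred0, hred, IsRoot.def, eval_map, ← aeval_def]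
      exact aeval_eq_zero_of_dvd_aeval_eq_zero hq_dvd hx
    obtain ⟨y, hy, rfl⟩ := Multiset.mem_map.1 hx'
    exact (hs_surj y hy).imp fun _ h ↦ congrArg _ h

/-- Dedekind's theorem, in the special case used in the paper: if `f ∈ ℤ[X]` is
monic of degree `n`, squarefree mod `p`, and factors mod `p` as a product of
`n − ℓ` distinct monic linear factors and one monic irreducible factor of
degree `ℓ`, then the Galois group of (the splitting field of) `f` over `ℚ`,
acting on the roots of `f` in `ℂ`, contains an `ℓ`-cycle. -/
theorem galois_contains_cycle_of_factorization
    (f : ℤ[X]) (hmonic : f.Monic) (n : ℕ) (hn : f.natDegree = n)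
    (p : ℕ) (hp : p.Prime) (ℓ : ℕ) (hℓ : 2 ≤ ℓ)
    (hsqf : Squarefree (f.map (Int.castRingHom (ZMod p))))
    (lin : Finset (ZMod p)) (q : (ZMod p)[X])
    (hlin : lin.card = n - ℓ) (hqirr : Irreducible q) (hqmonic : q.Monic)
    (hqdeg : q.natDegree = ℓ)
    (hfactor : f.map (Int.castRingHom (ZMod p)) = (∏ c ∈ lin, (X - C c)) * q) :
    ∃ σ : (f.map (Int.castRingHom ℚ)).Gal,
      (Polynomial.Gal.galActionHom (f.map (Int.castRingHom ℚ)) ℂ σ).IsCycle ∧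
      (Polynomial.Gal.galActionHom (f.map (Int.castRingHom ℚ)) ℂ σ).support.card = ℓ := by
  have : Fact p.Prime := ⟨hp⟩
  subst hqdeg
  let _ : Algebra ℚ (f.map (Int.castRingHom ℚ)).SplittingField := SplittingField.instAlgebra_1 _
  obtain ⟨σ, hσ⟩ := exists_gal_isCycle_of_factorization hmonic hsqf hqirr hℓ hfactor
    (f.map (Int.castRingHom ℚ)).SplittingField
  refine ⟨σ, hσ (Gal.rootsEquivRoots (f.map (Int.castRingHom ℚ)) ℂ).symm _ fun a ↦ ?_⟩
  exact congrArg Subtype.val (Equiv.symm_apply_apply _ _)
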